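/- Fix r ∈ ℕ. Then Σ_{n ≤ x} τ_r(n) f₁(n) = (C₀ x (log x)^{r²−1}/(r²−1)!) (1 + O(1/log x)) as x → ∞, where C₀ = Π_p (1 − 1/p)^{r²+r} Σ_{j≥0} τ_r(p^j) τ_{r+1}(p^j)/p^j. -/

import Mathlib

open Filter Finset

/-- `τ_r(n)`, the `r`-th divisor function: the number of ordered `r`-tuples of positive
integers whose product is `n`; equivalently the coefficient of `n^{-s}` in `ζ(s)^r`. -/
noncomputable def tauR (r n : ℕ) : ℕ := (ArithmeticFunction.zeta ^ r : ArithmeticFunction ℕ) n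

/-- The multiplicative function `f₁` determined on prime powers by
`f₁(p^e) = (Σ_{j≥0} τ_r(p^{e+j})/p^j) / (Σ_{j≥0} τ_r(p^j)/p^j)`. -/
noncomputable def fOne (r n : ℕ) : ℝ :=
  ∏ p ∈ n.primeFactors,
    (∑' j : ℕ, (tauR r (p ^ (n.factorization p + j)) : ℝ) / p ^ j) /
      (∑' j : ℕ, (tauR r (p ^ j) : ℝ) / p ^ j)

/-- `C₀ = Π_p (1 − 1/p)^{r²+r} Σ_{j≥0} τ_r(p^j) τ_{r+1}(p^j)/p^j`. -/
noncomputable def constC0 (r : ℕ) : ℝ :=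
  ∏' p : Nat.Primes,
    ((1 - 1 / ((p : ℕ) : ℝ)) ^ (r ^ 2 + r) *
      ∑' j : ℕ, ((tauR r ((p : ℕ) ^ j) : ℝ) * tauR (r + 1) ((p : ℕ) ^ j)) / (p : ℕ) ^ j)

/-- The partial sum `Σ_{n ≤ x} f(n)` of an arithmetic function. -/
noncomputable def partialSum (f : ArithmeticFunction ℝ) (x : ℝ) : ℝ :=
  ∑ n ∈ Ioc 0 ⌊x⌋₊, f n

/-- Zeta as a real-valued arithmetic function. -/
noncomputable abbrev zetaReal : ArithmeticFunction ℝ := ↑ArithmeticFunction.zeta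

/-- Möbius as a real-valued arithmetic function. -/
noncomputable abbrev moebiusReal : ArithmeticFunction ℝ := ↑ArithmeticFunction.moebius

lemma partialSum_mul (f g : ArithmeticFunction ℝ) (x : ℝ) :
    partialSum (f * g) x = ∑ n ∈ Ioc 0 ⌊x⌋₊, f n * partialSum g (x / n) := by
  simp only [partialSum, ArithmeticFunction.sum_Ioc_mul_eq_sum_sum, Nat.floor_div_natCast]

lemma partialSum_of_lt_one (f : ArithmeticFunction ℝ) {x : ℝ} (hx : x < 1) :
    partialSum f x = 0 := by
  simp [partialSum, Nat.floor_eq_zero.mpr hx]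

lemma succ_mul_pow_mul_sub_le {a b : ℝ} (hb : 0 ≤ b) (hab : b ≤ a) (m : ℕ) :
    (m + 1) * b ^ m * (a - b) ≤ a ^ (m + 1) - b ^ (m + 1) := by
  induction m with
  | zero => simp
  | succ m ih =>
    have h1 : b ^ (m + 1) ≤ a ^ (m + 1) := by gcongr
    have h2 := mul_le_mul_of_nonneg_left ih hb
    have h3 := mul_le_mul_of_nonneg_right h1 (sub_nonneg.mpr hab)
    push_cast
    have e1 : ((m : ℝ) + 1 + 1) * b ^ (m + 1) * (a - b) =
      b * ((m + 1) * b ^ m * (a - b)) + b ^ (m + 1) * (a - b) := by ring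
    have e2 : a ^ (m + 1 + 1) - b ^ (m + 1 + 1) =
      b * (a ^ (m + 1) - b ^ (m + 1)) + a ^ (m + 1) * (a - b) := by ring
    rw [e1, e2]
    linarith

lemma pow_sub_pow_le_succ_mul {a b : ℝ} (hb : 0 ≤ b) (hab : b ≤ a) (m : ℕ) :
    a ^ (m + 1) - b ^ (m + 1) ≤ (m + 1) * a ^ m * (a - b) := by
  have h := abs_pow_sub_pow_le a b (m + 1)
  rw [abs_of_nonneg (hb.trans hab), abs_of_nonneg hb, abs_of_nonneg (sub_nonneg.mpr hab),
    max_eq_left hab] at h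
  refine (le_abs_self _).trans (h.trans_eq ?_)
  push_cast
  ring

lemma inv_succ_le_log_sub_log {n : ℕ} (hn : 0 < n) :
    1 / ((n : ℝ) + 1) ≤ Real.log (n + 1) - Real.log n := by
  have hn' : (0 : ℝ) < n := by exact_mod_cast hn
  rw [← Real.log_div (by positivity) hn'.ne']
  refine le_trans (le_of_eq ?_) (Real.one_sub_inv_le_log_of_pos (by positivity))
  field_simp
  ring

lemma log_sub_log_le_inv {n : ℕ} (hn : 0 < n) :
    Real.log (n + 1) - Real.log n ≤ 1 / (n : ℝ) := by
  have hn' : (0 : ℝ) < n := by exact_mod_cast hn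
  rw [← Real.log_div (by positivity) hn'.ne']
  refine (Real.log_le_sub_one_of_pos (by positivity)).trans (le_of_eq ?_)
  field_simp
  ring

lemma sum_log_pow_div_le (m : ℕ) {N : ℕ} (hN : 1 ≤ N) {x : ℝ} (hx : N ≤ x) :
    ∑ n ∈ Ioc 0 N, Real.log (x / n) ^ m / n ≤
      Real.log x ^ m + (Real.log x ^ (m + 1) - Real.log (x / N) ^ (m + 1)) / (m + 1) := by
  induction N, hN using Nat.le_induction with
  | base => simp
  | succ N hN ih =>
    have hN0 : (0 : ℝ) < N := by exact_mod_cast hN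
    push_cast at hx
    have hxN : (N : ℝ) ≤ x := by linarith
    have hx0 : 0 < x := by linarith
    rw [Finset.sum_Ioc_succ_top (Nat.zero_le N)]
    push_cast
    have hb : 0 ≤ Real.log (x / (N + 1)) := Real.log_nonneg (by rwa [one_le_div (by positivity)])
    have hd := inv_succ_le_log_sub_log (n := N) hN
    have hab : Real.log (x / N) - Real.log (x / (N + 1)) = Real.log (N + 1) - Real.log N := by
      rw [Real.log_div hx0.ne' hN0.ne', Real.log_div hx0.ne' (by positivity)]; ring
    have h1 := succ_mul_pow_mul_sub_le hb (a := Real.log (x / N))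
      (by have : 0 ≤ 1 / ((N : ℝ) + 1) := by positivity
          linarith) m
    have h2 : Real.log (x / (N + 1)) ^ m / (N + 1) ≤
        (Real.log (x / N) ^ (m + 1) - Real.log (x / (N + 1)) ^ (m + 1)) / (m + 1) := by
      rw [le_div_iff₀ (by positivity)]
      refine le_trans ?_ h1
      rw [hab]
      have := mul_le_mul_of_nonneg_left hd (a := (m + 1) * Real.log (x / (N + 1)) ^ m)
        (by positivity)
      refine le_trans (le_of_eq ?_) this
      ring
    refine (add_le_add (ih hxN) h2).trans (le_of_eq ?_)
    ring

lemma le_sum_log_pow_div (m : ℕ) {N : ℕ} (hN : 1 ≤ N) {x : ℝ} (hx : N ≤ x) :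
    (Real.log x ^ (m + 1) - Real.log (x / N) ^ (m + 1)) / (m + 1) + Real.log (x / N) ^ m / N ≤
      ∑ n ∈ Ioc 0 N, Real.log (x / n) ^ m / n := by
  induction N, hN using Nat.le_induction with
  | base => simp
  | succ N hN ih =>
    have hN0 : (0 : ℝ) < N := by exact_mod_cast hN
    push_cast at hx
    have hxN : (N : ℝ) ≤ x := by linarith
    have hx0 : 0 < x := by linarith
    rw [Finset.sum_Ioc_succ_top (Nat.zero_le N)]
    push_cast
    have hb : 0 ≤ Real.log (x / (N + 1)) := Real.log_nonneg (by rwa [one_le_div (by positivity)])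
    have hd := inv_succ_le_log_sub_log (n := N) hN
    have hd' := log_sub_log_le_inv (n := N) hN
    have hab : Real.log (x / N) - Real.log (x / (N + 1)) = Real.log (N + 1) - Real.log N := by
      rw [Real.log_div hx0.ne' hN0.ne', Real.log_div hx0.ne' (by positivity)]; ring
    have hba : Real.log (x / (N + 1)) ≤ Real.log (x / N) := by
      have : 0 ≤ 1 / ((N : ℝ) + 1) := by positivity
      linarith
    have h1 := pow_sub_pow_le_succ_mul hb hba m
    have h2 : (Real.log (x / N) ^ (m + 1) - Real.log (x / (N + 1)) ^ (m + 1)) / (m + 1) ≤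
        Real.log (x / N) ^ m / N := by
      rw [div_le_iff₀ (by positivity)]
      refine h1.trans ?_
      rw [hab]
      have hc : 0 ≤ (m + 1) * Real.log (x / N) ^ m := by
        have := hb.trans hba
        positivity
      have := mul_le_mul_of_nonneg_left hd' hc
      refine this.trans (le_of_eq ?_)
      ring
    have h3 := ih hxN
    have e : (Real.log x ^ (m + 1) - Real.log (x / (N + 1)) ^ (m + 1)) / ((m : ℝ) + 1) =
      (Real.log x ^ (m + 1) - Real.log (x / N) ^ (m + 1)) / ((m : ℝ) + 1) +
      (Real.log (x / N) ^ (m + 1) - Real.log (x / (N + 1)) ^ (m + 1)) / (m + 1) := by ring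
    rw [e]
    linarith

/-- `Σ_{n ≤ x} log(x/n)^m / n = (log x)^{m+1}/(m+1) + O((log x)^m)`. -/
lemma abs_sum_log_pow_div_sub_le (m : ℕ) {x : ℝ} (hx : 1 ≤ x) :
    |∑ n ∈ Ioc 0 ⌊x⌋₊, Real.log (x / n) ^ m / n - Real.log x ^ (m + 1) / (m + 1)| ≤
      Real.log x ^ m := by
  have hN : 1 ≤ ⌊x⌋₊ := (Nat.one_le_floor_iff x).mpr hx
  have hN0 : (0 : ℝ) < ⌊x⌋₊ := by exact_mod_cast hN
  have hNx : (⌊x⌋₊ : ℝ) ≤ x := Nat.floor_le (by linarith)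
  have hL : 0 ≤ Real.log x := Real.log_nonneg hx
  have ha : 0 ≤ Real.log (x / ⌊x⌋₊) := Real.log_nonneg (by rwa [one_le_div hN0])
  have ha' : Real.log (x / ⌊x⌋₊) ≤ 1 / ⌊x⌋₊ := by
    refine (Real.log_le_sub_one_of_pos (by positivity)).trans ?_
    have := (Nat.lt_floor_add_one x).le
    rw [div_sub_one hN0.ne']
    gcongr
    linarith
  have h1 := sum_log_pow_div_le m hN hNx
  have h2 := le_sum_log_pow_div m hN hNx
  have h3 : Real.log (x / ⌊x⌋₊) ^ (m + 1) / (m + 1) ≤ Real.log (x / ⌊x⌋₊) ^ m / ⌊x⌋₊ := by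
    calc Real.log (x / ⌊x⌋₊) ^ (m + 1) / (m + 1)
        ≤ Real.log (x / ⌊x⌋₊) ^ (m + 1) :=
          div_le_self (by positivity) (by linarith [Nat.cast_nonneg (α := ℝ) m])
      _ = Real.log (x / ⌊x⌋₊) ^ m * Real.log (x / ⌊x⌋₊) := pow_succ _ _
      _ ≤ Real.log (x / ⌊x⌋₊) ^ m * (1 / ⌊x⌋₊) := by gcongr
      _ = _ := by ring
  have h4 : 0 ≤ Real.log (x / ⌊x⌋₊) ^ (m + 1) / (m + 1) := by positivity
  rw [sub_div] at h1 h2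
  rw [abs_le]
  constructor <;> linarith [pow_nonneg hL m]

/-- Asymptotics of the summatory function of `τ_{k+2}`. -/
lemma exists_abs_partialSum_zeta_pow_sub_le (k : ℕ) :
    ∃ C : ℝ, 0 ≤ C ∧ ∀ x : ℝ, 1 ≤ x →
      |partialSum (zetaReal ^ (k + 2)) x - x * Real.log x ^ (k + 1) / (k + 1).factorial| ≤
        C * x * (1 + Real.log x) ^ k := by
  induction k with
  | zero =>
    refine ⟨2, by norm_num, fun x hx ↦ ?_⟩
    have h0 := abs_sum_log_pow_div_sub_le 0 hx
    have h1 : partialSum (zetaReal ^ (0 + 2)) x = ∑ n ∈ Ioc 0 ⌊x⌋₊, ((⌊x⌋₊ / n : ℕ) : ℝ) := by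
      rw [zero_add, pow_two, partialSum, ArithmeticFunction.sum_Ioc_mul_zeta_eq_sum]
      refine sum_congr rfl fun n hn ↦ ?_
      rw [ArithmeticFunction.natCoe_apply,
        ArithmeticFunction.zeta_apply_ne (by simp at hn; omega)]
      simp
    have h2 : |∑ n ∈ Ioc 0 ⌊x⌋₊, (((⌊x⌋₊ / n : ℕ) : ℝ) - x / n)| ≤ x := by
      refine (abs_sum_le_sum_abs _ _).trans ?_
      refine (sum_le_card_nsmul _ _ 1 fun n hn ↦ ?_).trans ?_
      · rw [← Nat.floor_div_natCast, abs_le]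
        have := Nat.lt_floor_add_one (x / n)
        have := Nat.floor_le (a := x / n) (by positivity)
        constructor <;> linarith
      · simpa using Nat.floor_le (by linarith : 0 ≤ x)
    rw [h1]
    simp only [pow_zero, zero_add, pow_one, Nat.cast_zero, div_one, Nat.factorial_one,
      Nat.cast_one, mul_one] at h0 ⊢
    have h3 := mul_le_mul_of_nonneg_left h0 (by linarith : 0 ≤ x)
    rw [← abs_of_nonneg (by linarith : 0 ≤ x), ← abs_mul, abs_of_nonneg (by linarith : 0 ≤ x),
      mul_sub, mul_sum] at h3
    rw [sum_sub_distrib] at h2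
    have e : ∀ n : ℕ, x * (1 / (n : ℝ)) = x / n := fun n ↦ by ring
    simp only [e] at h3
    rw [abs_le] at *
    constructor <;> linarith [h2.1, h2.2, h3.1, h3.2]
  | succ k ih =>
    obtain ⟨C, hC, ih⟩ := ih
    refine ⟨C * 2 + 1, by positivity, fun x hx ↦ ?_⟩
    have hL : 0 ≤ Real.log x := Real.log_nonneg hx
    have hx0 : 0 < x := by linarith
    set N := ⌊x⌋₊ with hN
    set L := Real.log x with hLdef
    have h1 : partialSum (zetaReal ^ (k + 1 + 2)) x =
        ∑ n ∈ Ioc 0 N, partialSum (zetaReal ^ (k + 2)) (x / n) := by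
      rw [show k + 1 + 2 = (k + 2) + 1 by ring, pow_succ', partialSum_mul]
      refine sum_congr rfl fun n hn ↦ ?_
      rw [ArithmeticFunction.natCoe_apply,
        ArithmeticFunction.zeta_apply_ne (by simp at hn; omega)]
      simp
    have hterm : ∀ n ∈ Ioc 0 N, |partialSum (zetaReal ^ (k + 2)) (x / n) -
        x / (k + 1).factorial * (Real.log (x / n) ^ (k + 1) / n)| ≤
        C * x * (1 + L) ^ k * (1 / n) := by
      intro n hn
      have hn' := mem_Ioc.mp hn
      have hn0 : (0 : ℝ) < n := by exact_mod_cast hn'.1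
      have hn1 : (1 : ℝ) ≤ n := by exact_mod_cast hn'.1
      have hnx : (n : ℝ) ≤ x := (Nat.le_floor_iff hx0.le).mp hn'.2
      have hxn : 1 ≤ x / n := by rwa [one_le_div hn0]
      have := ih _ hxn
      rw [show x / (k + 1).factorial * (Real.log (x / n) ^ (k + 1) / n) =
        x / n * Real.log (x / n) ^ (k + 1) / (k + 1).factorial by ring]
      refine this.trans ?_
      have hlog : Real.log (x / n) ≤ L :=
        Real.log_le_log (by positivity) (div_le_self hx0.le hn1)
      have hlog0 := Real.log_nonneg hxn
      calc C * (x / n) * (1 + Real.log (x / n)) ^ k ≤ C * (x / n) * (1 + L) ^ k := by gcongr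
        _ = _ := by ring
    have hsum := (abs_sum_le_sum_abs _ _).trans (sum_le_sum hterm)
    rw [← mul_sum, sum_sub_distrib, ← mul_sum, ← h1] at hsum
    have h0 := abs_sum_log_pow_div_sub_le 0 hx
    simp only [pow_zero, zero_add, pow_one, Nat.cast_zero, div_one] at h0
    have h0' : ∑ n ∈ Ioc 0 N, 1 / (n : ℝ) ≤ 2 * (1 + L) := by
      have := (abs_le.mp h0).2
      linarith
    have hA : C * x * (1 + L) ^ k * ∑ n ∈ Ioc 0 N, 1 / (n : ℝ) ≤
        C * 2 * x * (1 + L) ^ (k + 1) := by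
      refine (mul_le_mul_of_nonneg_left h0' (by positivity)).trans (le_of_eq ?_)
      ring
    have hB := mul_le_mul_of_nonneg_left (abs_sum_log_pow_div_sub_le (k + 1) hx)
      (by positivity : 0 ≤ x / (k + 1).factorial)
    rw [← abs_of_nonneg (by positivity : 0 ≤ x / (k + 1).factorial), ← abs_mul,
      abs_of_nonneg (by positivity : 0 ≤ x / (k + 1).factorial), mul_sub] at hB
    have hB' : x / (k + 1).factorial * L ^ (k + 1) ≤ x * (1 + L) ^ (k + 1) := by
      have : x / (k + 1).factorial ≤ x :=
        div_le_self hx0.le (by exact_mod_cast (k + 1).factorial_pos)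
      have : L ^ (k + 1) ≤ (1 + L) ^ (k + 1) := by gcongr; linarith
      gcongr
    have e : x / (k + 1).factorial * (L ^ (k + 1 + 1) / (((k + 1 : ℕ) : ℝ) + 1)) =
        x * L ^ (k + 1 + 1) / (k + 1 + 1).factorial := by
      rw [Nat.factorial_succ (k + 1)]
      push_cast
      field_simp
    rw [e] at hB
    have := abs_sub_le (partialSum (zetaReal ^ (k + 1 + 2)) x)
      (x / (k + 1).factorial * ∑ n ∈ Ioc 0 N, Real.log (x / n) ^ (k + 1) / n)
      (x * L ^ (k + 1 + 1) / (k + 1 + 1).factorial)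
    refine this.trans ?_
    linarith

/-- If `Σ |h(n)| n^{-3/4}` converges, then the summatory function of `h * τ_{k+2}` is
`(Σ h(n)/n) x (log x)^{k+1}/(k+1)!` up to `O(x (1 + log x)^k)`. -/
lemma exists_abs_partialSum_mul_zeta_pow_sub_le (h : ArithmeticFunction ℝ) (k : ℕ)
    (hh : Summable fun n : ℕ ↦ |h n| * (n : ℝ) ^ (-(3 / 4) : ℝ)) :
    ∃ C : ℝ, ∀ x : ℝ, 1 ≤ x →
      |partialSum (h * zetaReal ^ (k + 2)) x -
          (∑' n : ℕ, h n / n) * (x * Real.log x ^ (k + 1) / (k + 1).factorial)| ≤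
        C * x * (1 + Real.log x) ^ k := by
  obtain ⟨C, hC, hD⟩ := exists_abs_partialSum_zeta_pow_sub_le k
  have hlog : ∀ n : ℕ, |h n| * (Real.log n / n) ≤ 4 * (|h n| * (n : ℝ) ^ (-(3 / 4) : ℝ)) := by
    intro n
    rcases Nat.eq_zero_or_pos n with rfl | hn
    · simp
    have hn0 : (0 : ℝ) < n := by exact_mod_cast hn
    have h1 := Real.log_le_rpow_div hn0.le (ε := 1 / 4) (by norm_num)
    have h2 : Real.log n / n ≤ 4 * (n : ℝ) ^ (-(3 / 4) : ℝ) := by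
      rw [show (-(3 / 4) : ℝ) = 1 / 4 - 1 by norm_num, Real.rpow_sub_one hn0.ne', ← mul_div_assoc]
      gcongr
      linarith
    refine (mul_le_mul_of_nonneg_left h2 (abs_nonneg _)).trans (le_of_eq ?_)
    ring
  have hinv : ∀ n : ℕ, |h n| * (1 / n) ≤ |h n| * (n : ℝ) ^ (-(3 / 4) : ℝ) := by
    intro n
    rcases Nat.eq_zero_or_pos n with rfl | hn
    · simp
    gcongr
    rw [one_div, ← Real.rpow_neg_one]
    exact Real.rpow_le_rpow_of_exponent_le (by exact_mod_cast hn) (by norm_num)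
  have hW : Summable fun n : ℕ ↦ |h n| * (Real.log n / n) :=
    (hh.mul_left 4).of_nonneg_of_le
      (fun n ↦ mul_nonneg (abs_nonneg _) (div_nonneg (Real.log_natCast_nonneg n) (by positivity)))
      hlog
  have hV : Summable fun n : ℕ ↦ |h n| * (1 / n) :=
    hh.of_nonneg_of_le (fun n ↦ by positivity) hinv
  have hV' : Summable fun n : ℕ ↦ h n / n := by
    refine Summable.of_norm (hV.congr fun n ↦ ?_)
    rw [Real.norm_eq_abs, abs_div, Nat.abs_cast]
    ring
  refine ⟨C * ∑' n : ℕ, |h n| * (1 / n) + (k + 1) * ∑' n : ℕ, |h n| * (Real.log n / n),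
    fun x hx ↦ ?_⟩
  have hx0 : 0 < x := by linarith
  have hL : 0 ≤ Real.log x := Real.log_nonneg hx
  set L := Real.log x with hLdef
  set D : ℝ → ℝ := partialSum (zetaReal ^ (k + 2)) with hDdef
  have hterm : ∀ n : ℕ, 0 < n → |D (x / n) - x / n * L ^ (k + 1) / (k + 1).factorial| ≤
      x * (1 + L) ^ k * (C * (1 / n) + (k + 1) * (Real.log n / n)) := by
    intro n hn
    have hn0 : (0 : ℝ) < n := by exact_mod_cast hn
    have hn1 : (1 : ℝ) ≤ n := by exact_mod_cast hn
    have hlogn := Real.log_nonneg hn1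
    have hfac : (1 : ℝ) ≤ (k + 1).factorial := by exact_mod_cast (k + 1).factorial_pos
    have hpow : L ^ k ≤ (1 + L) ^ k := by gcongr; linarith
    rcases le_or_gt (n : ℝ) x with hnx | hnx
    · have hy : 1 ≤ x / n := by rwa [one_le_div hn0]
      have hly : Real.log (x / n) = L - Real.log n := Real.log_div hx0.ne' hn0.ne'
      have hly0 := Real.log_nonneg hy
      have hlyL : Real.log (x / n) ≤ L := by linarith
      have h1 : |D (x / n) - x / n * Real.log (x / n) ^ (k + 1) / (k + 1).factorial| ≤
          C * (x / n) * (1 + L) ^ k :=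
        (hD _ hy).trans (by gcongr)
      have h2 : |x / n * Real.log (x / n) ^ (k + 1) / (k + 1).factorial -
          x / n * L ^ (k + 1) / (k + 1).factorial| ≤
          x / n * ((k + 1) * (1 + L) ^ k * Real.log n) := by
        rw [abs_sub_comm, ← sub_div, ← mul_sub, abs_of_nonneg (by
          have : Real.log (x / n) ^ (k + 1) ≤ L ^ (k + 1) := by gcongr
          have := sub_nonneg.mpr this
          positivity)]
        have h3 := pow_sub_pow_le_succ_mul hly0 hlyL k
        rw [show L - Real.log (x / n) = Real.log n by rw [hly]; ring] at h3
        refine (div_le_self ?_ hfac).trans ?_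
        · have : Real.log (x / n) ^ (k + 1) ≤ L ^ (k + 1) := by gcongr
          have := sub_nonneg.mpr this
          positivity
        · gcongr
          exact h3.trans (by gcongr)
      refine (abs_sub_le _ _ _).trans ((add_le_add h1 h2).trans (le_of_eq ?_))
      ring
    · have hy : x / n < 1 := by rwa [div_lt_one hn0]
      have hlogx : L ≤ Real.log n := Real.log_le_log hx0 hnx.le
      rw [hDdef, partialSum_of_lt_one _ hy, zero_sub, abs_neg, abs_of_nonneg (by positivity)]
      calc x / n * L ^ (k + 1) / (k + 1).factorial ≤ x / n * L ^ (k + 1) :=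
            div_le_self (by positivity) hfac
        _ = x / n * (1 * L ^ k * L) := by ring
        _ ≤ x / n * ((k + 1) * (1 + L) ^ k * Real.log n) := by
            gcongr
            linarith [Nat.cast_nonneg (α := ℝ) k]
        _ = x * (1 + L) ^ k * ((k + 1) * (Real.log n / n)) := by ring
        _ ≤ _ := by
            gcongr
            have : 0 ≤ C * (1 / n) := by positivity
            linarith
  have hsum1 : HasSum (fun n : ℕ ↦ h n * D (x / n)) (partialSum (h * zetaReal ^ (k + 2)) x) := by
    rw [partialSum_mul]
    refine hasSum_sum_of_ne_finset_zero fun n hn ↦ ?_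
    rcases Nat.eq_zero_or_pos n with rfl | hn0
    · simp
    have : ⌊x⌋₊ < n := by
      by_contra! hc
      exact hn (mem_Ioc.mpr ⟨hn0, hc⟩)
    rw [hDdef, partialSum_of_lt_one, mul_zero]
    rw [div_lt_one (by exact_mod_cast hn0)]
    exact (Nat.floor_lt hx0.le).mp this
  have hsum2 := hsum1.sub (hV'.hasSum.mul_right (x * L ^ (k + 1) / (k + 1).factorial))
  have hsum3 := ((hV.hasSum.mul_left C).add (hW.hasSum.mul_left ((k : ℝ) + 1))).mul_left
    (x * (1 + L) ^ k)
  rw [← Real.norm_eq_abs]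
  refine (hsum2.norm_le_of_bounded hsum3 fun n ↦ ?_).trans (le_of_eq (by ring))
  rcases Nat.eq_zero_or_pos n with rfl | hn0
  · simp
  rw [show h n * D (x / n) - h n / n * (x * L ^ (k + 1) / (k + 1).factorial) =
    h n * (D (x / n) - x / n * L ^ (k + 1) / (k + 1).factorial) by ring, norm_mul,
    Real.norm_eq_abs, Real.norm_eq_abs]
  refine (mul_le_mul_of_nonneg_left (hterm n hn0) (abs_nonneg _)).trans (le_of_eq ?_)
  ring

/-- A nonnegative multiplicative function whose Euler factors are at most `1 + c p` with
`Σ c` convergent is summable. -/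
lemma summable_of_multiplicative_of_tsum_prime_pow_le {f : ℕ → ℝ} (hf : ∀ n, 0 ≤ f n)
    (hf0 : f 0 = 0) (hf1 : f 1 = 1)
    (hmul : ∀ {m n : ℕ}, m.Coprime n → f (m * n) = f m * f n)
    (hpow : ∀ {p : ℕ}, p.Prime → Summable fun e : ℕ ↦ f (p ^ e))
    {c : ℕ → ℝ} (hc : Summable c) (hc0 : ∀ n, 0 ≤ c n)
    (hle : ∀ {p : ℕ}, p.Prime → ∑' e : ℕ, f (p ^ e) ≤ 1 + c p) : Summable f := by
  refine summable_of_sum_range_le (c := Real.exp (∑' n, c n)) hf fun N ↦ ?_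
  obtain ⟨hs, hs'⟩ := EulerProduct.summable_and_hasSum_smoothNumbers_prod_primesBelow_tsum
    (f := f) hf1 hmul (fun hp ↦ (hpow hp).norm) N
  have h1 : ∑ i ∈ range N, f i ≤ ∑' m : N.smoothNumbers, f m := by
    rw [tsum_subtype N.smoothNumbers f]
    have hsum : Summable (Set.indicator N.smoothNumbers f) := summable_subtype_iff_indicator.mp
      hs'.summable
    refine le_trans (sum_le_sum fun i hi ↦ ?_)
      (hsum.sum_le_tsum (range N) fun i _ ↦ Set.indicator_nonneg (fun i _ ↦ hf i) i)
    rcases Nat.eq_zero_or_pos i with rfl | hi0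
    · rw [hf0]; exact Set.indicator_nonneg (fun i _ ↦ hf i) 0
    · rw [Set.indicator_of_mem]
      exact Nat.mem_smoothNumbers_of_lt hi0 (mem_range.mp hi)
  rw [hs'.tsum_eq] at h1
  calc _ ≤ _ := h1
    _ ≤ ∏ p ∈ N.primesBelow, Real.exp (c p) := by
        refine prod_le_prod (fun p _ ↦ tsum_nonneg fun e ↦ hf _) fun p hp ↦ ?_
        have := Real.add_one_le_exp (c p)
        linarith [hle (Nat.prime_of_mem_primesBelow hp)]
    _ = Real.exp (∑ p ∈ N.primesBelow, c p) := (Real.exp_sum _ _).symm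
    _ ≤ _ := Real.exp_le_exp.mpr (hc.sum_le_tsum _ fun n _ ↦ hc0 n)

lemma mul_apply_prime_pow (f g : ArithmeticFunction ℝ) {p : ℕ} (hp : p.Prime) (n : ℕ) :
    (f * g) (p ^ n) = ∑ ij ∈ antidiagonal n, f (p ^ ij.1) * g (p ^ ij.2) := by
  rw [ArithmeticFunction.mul_apply, Nat.sum_divisorsAntidiagonal (fun a b ↦ f a * g b),
    Nat.sum_divisors_prime_pow hp, Nat.sum_antidiagonal_eq_sum_range_succ_mk]
  refine sum_congr rfl fun i hi ↦ ?_
  rw [Nat.pow_div (Nat.lt_succ_iff.mp (mem_range.mp hi)) hp.pos]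

lemma abs_mul_apply_prime_pow_le {f g : ArithmeticFunction ℝ} {p a b : ℕ} {A : ℝ} (hA : 0 ≤ A)
    (hp : p.Prime) (hf : ∀ e : ℕ, |f (p ^ e)| ≤ A * ((e : ℝ) + 1) ^ a)
    (hg : ∀ e : ℕ, |g (p ^ e)| ≤ ((e : ℝ) + 1) ^ b) (e : ℕ) :
    |(f * g) (p ^ e)| ≤ A * ((e : ℝ) + 1) ^ (a + b + 1) := by
  rw [mul_apply_prime_pow f g hp]
  refine (abs_sum_le_sum_abs _ _).trans ((sum_le_card_nsmul _ _
    (A * ((e : ℝ) + 1) ^ a * ((e : ℝ) + 1) ^ b) fun ij hij ↦ ?_).trans (le_of_eq ?_))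
  · rw [abs_mul]
    have hij' := mem_antidiagonal.mp hij
    have h1 : (ij.1 : ℝ) ≤ e := by exact_mod_cast (by omega)
    have h2 : (ij.2 : ℝ) ≤ e := by exact_mod_cast (by omega)
    refine mul_le_mul ((hf _).trans ?_) ((hg _).trans ?_) (abs_nonneg _) (by positivity) <;> gcongr
  · simp
    ring

lemma abs_pow_apply_prime_pow_le {f : ArithmeticFunction ℝ} {p : ℕ} (hp : p.Prime)
    (hf : ∀ e : ℕ, |f (p ^ e)| ≤ 1) (k e : ℕ) : |(f ^ k) (p ^ e)| ≤ ((e : ℝ) + 1) ^ k := by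
  induction k generalizing e with
  | zero =>
    rw [pow_zero, ArithmeticFunction.one_apply]
    split_ifs <;> simp
  | succ k ih =>
    rw [pow_succ]
    simpa using abs_mul_apply_prime_pow_le zero_le_one hp (a := k) (b := 0) (by simpa using ih)
      (by simpa using hf) e

lemma abs_moebiusReal_apply_le (n : ℕ) : |moebiusReal n| ≤ 1 := by
  rw [ArithmeticFunction.intCoe_apply]
  exact_mod_cast ArithmeticFunction.abs_moebius_le_one

lemma zetaReal_apply_prime_pow {p : ℕ} (hp : p.Prime) (e : ℕ) : zetaReal (p ^ e) = 1 := by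
  rw [ArithmeticFunction.natCoe_apply, ArithmeticFunction.zeta_apply_ne (pow_pos hp.pos e).ne',
    Nat.cast_one]

lemma cast_tauR (r n : ℕ) : (tauR r n : ℝ) = (zetaReal ^ r) n := by
  have : ((ArithmeticFunction.zeta ^ r : ArithmeticFunction ℕ) : ArithmeticFunction ℝ) =
      zetaReal ^ r := by
    induction r with
    | zero => simp
    | succ r ih => rw [pow_succ, pow_succ, ArithmeticFunction.natCoe_mul, ih]
  rw [← this, ArithmeticFunction.natCoe_apply, tauR]

lemma tauR_apply_prime_pow_le (r : ℕ) {p : ℕ} (hp : p.Prime) (e : ℕ) :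
    (tauR r (p ^ e) : ℝ) ≤ ((e : ℝ) + 1) ^ r := by
  rw [cast_tauR]
  exact (le_abs_self _).trans
    (abs_pow_apply_prime_pow_le hp (fun e ↦ by simp [zetaReal_apply_prime_pow hp]) r e)

lemma tauR_one (r : ℕ) : tauR r 1 = 1 := by
  rw [tauR]
  exact (ArithmeticFunction.isMultiplicative_zeta.pow (k := r)).map_one

lemma tauR_succ_apply_prime_pow (r : ℕ) {p : ℕ} (hp : p.Prime) (e : ℕ) :
    tauR (r + 1) (p ^ e) = ∑ i ∈ range (e + 1), tauR r (p ^ i) := by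
  rw [tauR, pow_succ, ArithmeticFunction.mul_zeta_apply, Nat.sum_divisors_prime_pow hp]
  rfl

lemma tauR_apply_prime (r : ℕ) {p : ℕ} (hp : p.Prime) : tauR r p = r := by
  induction r with
  | zero => simp [tauR, hp.ne_one]
  | succ r ih =>
    have := tauR_succ_apply_prime_pow r hp 1
    simp only [pow_one, sum_range_succ, range_zero, sum_empty, pow_zero, tauR_one, ih] at this
    omega

/-- The local factor of the Dirichlet series at `s = 1`. -/
lemma tsum_mul_apply_prime_pow {f g : ArithmeticFunction ℝ} {p : ℕ} (hp : p.Prime) {x : ℝ}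
    (hf : Summable fun e : ℕ ↦ ‖f (p ^ e) * x ^ e‖)
    (hg : Summable fun e : ℕ ↦ ‖g (p ^ e) * x ^ e‖) :
    Summable (fun e : ℕ ↦ ‖(f * g) (p ^ e) * x ^ e‖) ∧
      ∑' e : ℕ, (f * g) (p ^ e) * x ^ e =
        (∑' e : ℕ, f (p ^ e) * x ^ e) * ∑' e : ℕ, g (p ^ e) * x ^ e := by
  have key : ∀ e : ℕ, (f * g) (p ^ e) * x ^ e = ∑ ij ∈ antidiagonal e,
      f (p ^ ij.1) * x ^ ij.1 * (g (p ^ ij.2) * x ^ ij.2) := by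
    intro e
    rw [mul_apply_prime_pow f g hp, sum_mul]
    refine sum_congr rfl fun ij hij ↦ ?_
    rw [← mem_antidiagonal.mp hij, pow_add]
    ring
  simp only [key]
  exact ⟨summable_norm_sum_mul_antidiagonal_of_summable_norm
      (f := fun e ↦ f (p ^ e) * x ^ e) (g := fun e ↦ g (p ^ e) * x ^ e) hf hg,
    (tsum_mul_tsum_eq_tsum_sum_antidiagonal_of_summable_norm
      (f := fun e ↦ f (p ^ e) * x ^ e) (g := fun e ↦ g (p ^ e) * x ^ e) hf hg).symm⟩

lemma tsum_pow_apply_prime_pow {f : ArithmeticFunction ℝ} {p : ℕ} (hp : p.Prime) {x : ℝ}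
    (hf : Summable fun e : ℕ ↦ ‖f (p ^ e) * x ^ e‖) (k : ℕ) :
    Summable (fun e : ℕ ↦ ‖(f ^ k) (p ^ e) * x ^ e‖) ∧
      ∑' e : ℕ, (f ^ k) (p ^ e) * x ^ e = (∑' e : ℕ, f (p ^ e) * x ^ e) ^ k := by
  induction k with
  | zero =>
    have h0 : ∀ e ∉ ({0} : Finset ℕ), (1 : ArithmeticFunction ℝ) (p ^ e) * x ^ e = 0 := by
      intro e he
      rw [ArithmeticFunction.one_apply, if_neg, zero_mul]
      rw [Nat.pow_eq_one]
      simp only [mem_singleton] at he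
      exact fun h ↦ h.elim hp.ne_one he
    simp only [pow_zero]
    exact ⟨(summable_of_ne_finset_zero h0).norm, by rw [tsum_eq_sum h0]; simp⟩
  | succ k ih =>
    have := tsum_mul_apply_prime_pow hp ih.1 hf
    rw [pow_succ, pow_succ, ← ih.2]
    exact this

lemma summable_add_pow_mul_geometric (c k : ℕ) {q : ℝ} (hq0 : 0 < q) (hq1 : q < 1) :
    Summable fun n : ℕ ↦ ((n : ℝ) + c) ^ k * q ^ n := by
  have h := summable_pow_mul_geometric_of_norm_lt_one k (r := q) (by rwa [Real.norm_of_nonneg hq0.le])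
  have h2 := ((summable_nat_add_iff c).mpr h).mul_right (q ^ c)⁻¹
  refine h2.congr fun n ↦ ?_
  push_cast
  rw [pow_add]
  field_simp

/-- The sum `Σ_{j ≥ 0} τ_r(p^{e+j}) / p^j`. -/
noncomputable def localSum (r p e : ℕ) : ℝ :=
  ∑' j : ℕ, (tauR r (p ^ (e + j)) : ℝ) * ((p : ℝ)⁻¹) ^ j

/-- The constant `Σ_{j ≥ 0} (j+1)^r / 2^j` bounding `localSum`. -/
noncomputable def localBound (r : ℕ) : ℝ := ∑' j : ℕ, ((j : ℝ) + 1) ^ r * (1 / 2 : ℝ) ^ j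

lemma localBound_nonneg (r : ℕ) : 0 ≤ localBound r := tsum_nonneg fun j ↦ by positivity

lemma inv_prime_le_half {p : ℕ} (hp : p.Prime) : (p : ℝ)⁻¹ ≤ 1 / 2 := by
  rw [one_div]
  exact inv_anti₀ two_pos (by exact_mod_cast hp.two_le)

lemma inv_prime_pos {p : ℕ} (hp : p.Prime) : 0 < (p : ℝ)⁻¹ :=
  inv_pos.mpr (by exact_mod_cast hp.pos)

lemma summable_succ_pow_mul_half_pow (r : ℕ) :
    Summable fun j : ℕ ↦ ((j : ℝ) + 1) ^ r * (1 / 2 : ℝ) ^ j := by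
  simpa using summable_add_pow_mul_geometric 1 r (q := 1 / 2) (by norm_num) (by norm_num)

lemma localSum_term_le (r : ℕ) {p : ℕ} (hp : p.Prime) (e j : ℕ) :
    (tauR r (p ^ (e + j)) : ℝ) * ((p : ℝ)⁻¹) ^ j ≤
      ((e : ℝ) + 1) ^ r * (((j : ℝ) + 1) ^ r * (1 / 2 : ℝ) ^ j) := by
  have h1 := tauR_apply_prime_pow_le r hp (e + j)
  have h2 : ((e + j : ℕ) : ℝ) + 1 ≤ ((e : ℝ) + 1) * ((j : ℝ) + 1) := by
    push_cast
    nlinarith [mul_nonneg (Nat.cast_nonneg (α := ℝ) e) (Nat.cast_nonneg (α := ℝ) j)]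
  have h3 := inv_prime_le_half hp
  have h4 := inv_prime_pos hp
  calc (tauR r (p ^ (e + j)) : ℝ) * ((p : ℝ)⁻¹) ^ j
      ≤ (((e : ℝ) + 1) * ((j : ℝ) + 1)) ^ r * (1 / 2 : ℝ) ^ j := by
        gcongr
        exact h1.trans (by gcongr)
    _ = _ := by rw [mul_pow]; ring

lemma summable_localSum (r : ℕ) {p : ℕ} (hp : p.Prime) (e : ℕ) :
    Summable fun j : ℕ ↦ (tauR r (p ^ (e + j)) : ℝ) * ((p : ℝ)⁻¹) ^ j :=
  ((summable_succ_pow_mul_half_pow r).mul_left _).of_nonneg_of_le (fun j ↦ by positivity)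
    (localSum_term_le r hp e)

lemma localSum_nonneg (r p e : ℕ) : 0 ≤ localSum r p e := tsum_nonneg fun j ↦ by positivity

lemma localSum_le (r : ℕ) {p : ℕ} (hp : p.Prime) (e : ℕ) :
    localSum r p e ≤ localBound r * ((e : ℝ) + 1) ^ r := by
  rw [mul_comm, localBound, ← tsum_mul_left]
  exact (summable_localSum r hp e).tsum_le_tsum (localSum_term_le r hp e)
    ((summable_succ_pow_mul_half_pow r).mul_left _)

lemma one_le_localSum_zero (r : ℕ) {p : ℕ} (hp : p.Prime) : 1 ≤ localSum r p 0 := by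
  have := (summable_localSum r hp 0).le_tsum 0 (fun j _ ↦ by positivity)
  simpa [localSum, tauR_one] using this

lemma exists_abs_localSum_one_sub_le (r : ℕ) :
    ∃ B : ℝ, 0 ≤ B ∧ ∀ p : ℕ, p.Prime →
      |localSum r p 1 - r * localSum r p 0| ≤ B * (p : ℝ)⁻¹ := by
  have hS : Summable fun j : ℕ ↦ (1 + r) * (((j : ℝ) + 3) ^ r * (1 / 2 : ℝ) ^ j) :=
    (by simpa using summable_add_pow_mul_geometric 3 r (q := 1 / 2) (by norm_num) (by norm_num) :
      Summable fun j : ℕ ↦ ((j : ℝ) + 3) ^ r * (1 / 2 : ℝ) ^ j).mul_left _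
  refine ⟨∑' j : ℕ, (1 + r) * (((j : ℝ) + 3) ^ r * (1 / 2 : ℝ) ^ j),
    tsum_nonneg fun j ↦ by positivity, fun p hp ↦ ?_⟩
  have h3 := inv_prime_le_half hp
  have h4 := inv_prime_pos hp
  have hd : HasSum (fun j : ℕ ↦ (tauR r (p ^ (1 + j)) : ℝ) * ((p : ℝ)⁻¹) ^ j -
      r * ((tauR r (p ^ (0 + j)) : ℝ) * ((p : ℝ)⁻¹) ^ j))
      (localSum r p 1 - r * localSum r p 0) :=
    (summable_localSum r hp 1).hasSum.sub ((summable_localSum r hp 0).hasSum.mul_left _)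
  rw [← hasSum_nat_add_iff' 1] at hd
  simp only [sum_range_one, add_zero, pow_one, pow_zero, tauR_one, tauR_apply_prime r hp,
    Nat.cast_one, mul_one, sub_self, sub_zero] at hd
  rw [← Real.norm_eq_abs]
  refine hd.norm_le_of_bounded (hS.hasSum.mul_right _) fun j ↦ ?_
  have h1 : (tauR r (p ^ (1 + (j + 1))) : ℝ) ≤ ((j : ℝ) + 3) ^ r :=
    (tauR_apply_prime_pow_le r hp _).trans (le_of_eq (by push_cast; ring))
  have h2 : (tauR r (p ^ (0 + (j + 1))) : ℝ) ≤ ((j : ℝ) + 3) ^ r :=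
    (tauR_apply_prime_pow_le r hp _).trans (by push_cast; gcongr ?_ ^ r; linarith)
  have h5 : |(tauR r (p ^ (1 + (j + 1))) : ℝ) - r * (tauR r (p ^ (0 + (j + 1))) : ℝ)| ≤
      (1 + r) * ((j : ℝ) + 3) ^ r := by
    have h6 := mul_le_mul_of_nonneg_left h2 (Nat.cast_nonneg (α := ℝ) r)
    have h7 : (0 : ℝ) ≤ tauR r (p ^ (1 + (j + 1))) := Nat.cast_nonneg _
    have h8 : (0 : ℝ) ≤ r * (tauR r (p ^ (0 + (j + 1))) : ℝ) := by positivity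
    rw [abs_le]
    constructor <;> nlinarith
  rw [← mul_assoc, ← sub_mul, norm_mul, norm_pow, norm_inv, Real.norm_natCast, Real.norm_eq_abs,
    pow_succ]
  calc _ ≤ (1 + r) * ((j : ℝ) + 3) ^ r * ((1 / 2) ^ j * (p : ℝ)⁻¹) := by gcongr
    _ = _ := by ring

lemma fOne_apply_prime_pow (r : ℕ) {p : ℕ} (hp : p.Prime) (e : ℕ) :
    fOne r (p ^ e) = localSum r p e / localSum r p 0 := by
  rcases Nat.eq_zero_or_pos e with rfl | he
  · rw [div_self (zero_lt_one.trans_le (one_le_localSum_zero r hp)).ne']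
    simp [fOne]
  · rw [fOne, Nat.primeFactors_prime_pow he.ne' hp, prod_singleton, hp.factorization_pow,
      Finsupp.single_eq_same]
    simp only [localSum, zero_add, inv_pow, div_eq_mul_inv]

lemma fOne_mul_of_coprime (r : ℕ) {m n : ℕ} (h : m.Coprime n) :
    fOne r (m * n) = fOne r m * fOne r n := by
  simp only [fOne]
  rw [h.primeFactors_mul, prod_union h.disjoint_primeFactors]
  congr 1
  · refine prod_congr rfl fun p hp ↦ ?_
    rw [Nat.factorization_eq_of_coprime_left h (Nat.mem_primeFactors_iff_mem_primeFactorsList.mp hp)]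
  · refine prod_congr rfl fun p hp ↦ ?_
    rw [Nat.factorization_eq_of_coprime_right h (Nat.mem_primeFactors_iff_mem_primeFactorsList.mp hp)]

/-- The arithmetic function `n ↦ τ_r(n) f₁(n)`. -/
noncomputable def tauMulFOne (r : ℕ) : ArithmeticFunction ℝ :=
  ⟨fun n ↦ tauR r n * fOne r n, by simp [tauR]⟩

lemma tauMulFOne_apply (r n : ℕ) : tauMulFOne r n = tauR r n * fOne r n := rfl

lemma isMultiplicative_tauMulFOne (r : ℕ) : (tauMulFOne r).IsMultiplicative := by
  refine ⟨by simp [tauMulFOne_apply, tauR_one, fOne], fun {m n} h ↦ ?_⟩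
  simp only [tauMulFOne_apply, fOne_mul_of_coprime r h, tauR]
  rw [(ArithmeticFunction.isMultiplicative_zeta.pow (k := r)).map_mul_of_coprime h]
  push_cast
  ring

lemma abs_tauMulFOne_apply_prime_pow_le (r : ℕ) {p : ℕ} (hp : p.Prime) (e : ℕ) :
    |tauMulFOne r (p ^ e)| ≤ localBound r * ((e : ℝ) + 1) ^ (r + r) := by
  have h0 := localSum_nonneg r p e
  have h1 := one_le_localSum_zero r hp
  rw [tauMulFOne_apply, fOne_apply_prime_pow r hp, abs_of_nonneg (by positivity)]
  calc _ ≤ ((e : ℝ) + 1) ^ r * (localBound r * ((e : ℝ) + 1) ^ r) := by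
        gcongr
        · exact tauR_apply_prime_pow_le r hp e
        · exact (div_le_self h0 h1).trans (localSum_le r hp e)
    _ = _ := by ring

/-- The Dirichlet convolution quotient of `τ_r f₁` by `τ_{r²}`. -/
noncomputable def quotientFun (r : ℕ) : ArithmeticFunction ℝ :=
  tauMulFOne r * moebiusReal ^ (r ^ 2)

lemma quotientFun_mul_zeta_pow (r : ℕ) : quotientFun r * zetaReal ^ (r ^ 2) = tauMulFOne r := by
  rw [quotientFun, mul_assoc, ← mul_pow, ArithmeticFunction.coe_moebius_mul_coe_zeta, one_pow,
    mul_one]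

lemma isMultiplicative_quotientFun (r : ℕ) : (quotientFun r).IsMultiplicative :=
  (isMultiplicative_tauMulFOne r).mul ArithmeticFunction.isMultiplicative_moebius.intCast.pow

lemma abs_quotientFun_apply_prime_pow_le (r : ℕ) {p : ℕ} (hp : p.Prime) (e : ℕ) :
    |quotientFun r (p ^ e)| ≤ localBound r * ((e : ℝ) + 1) ^ (r + r + r ^ 2 + 1) :=
  abs_mul_apply_prime_pow_le (localBound_nonneg r) hp (abs_tauMulFOne_apply_prime_pow_le r hp)
    (abs_pow_apply_prime_pow_le hp (fun _ ↦ abs_moebiusReal_apply_le _) _) e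

lemma mul_apply_prime {f g : ArithmeticFunction ℝ} (hf : f 1 = 1) (hg : g 1 = 1) {p : ℕ}
    (hp : p.Prime) : (f * g) p = f p + g p := by
  have := mul_apply_prime_pow f g hp 1
  rw [Nat.sum_antidiagonal_eq_sum_range_succ_mk] at this
  simpa [sum_range_succ, hf, hg, add_comm] using this

lemma pow_moebiusReal_apply_prime (k : ℕ) {p : ℕ} (hp : p.Prime) :
    (moebiusReal ^ k) p = -k := by
  have hM := ArithmeticFunction.isMultiplicative_moebius.intCast (R := ℝ)
  induction k with
  | zero => simp [hp.ne_one]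
  | succ k ih =>
    rw [pow_succ, mul_apply_prime (hM.pow (k := k)).map_one hM.map_one hp, ih,
      ArithmeticFunction.intCoe_apply, ArithmeticFunction.moebius_apply_prime hp]
    push_cast
    ring

lemma exists_abs_quotientFun_apply_prime_le (r : ℕ) :
    ∃ B : ℝ, 0 ≤ B ∧ ∀ p : ℕ, p.Prime → |quotientFun r p| ≤ B * (p : ℝ)⁻¹ := by
  obtain ⟨B, hB, h⟩ := exists_abs_localSum_one_sub_le r
  refine ⟨r * B, by positivity, fun p hp ↦ ?_⟩
  have h1 := one_le_localSum_zero r hp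
  have h0 : 0 < localSum r p 0 := by linarith
  have hM := (ArithmeticFunction.isMultiplicative_moebius.intCast (R := ℝ)).pow (k := r ^ 2)
  have hf := fOne_apply_prime_pow r hp 1
  rw [pow_one] at hf
  have e : quotientFun r p = r * ((localSum r p 1 - r * localSum r p 0) / localSum r p 0) := by
    rw [quotientFun, mul_apply_prime (isMultiplicative_tauMulFOne r).map_one hM.map_one hp,
      pow_moebiusReal_apply_prime _ hp, tauMulFOne_apply, hf, tauR_apply_prime r hp]
    push_cast
    field_simp
    ring
  rw [e, abs_mul, abs_div, Nat.abs_cast, abs_of_pos h0, mul_assoc]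
  gcongr
  exact (div_le_self (abs_nonneg _) h1).trans (h p hp)

lemma tsum_zeta_pow_apply_prime_pow (k : ℕ) {p : ℕ} (hp : p.Prime) :
    ∑' e : ℕ, (zetaReal ^ k) (p ^ e) * ((p : ℝ)⁻¹) ^ e = (1 - (p : ℝ)⁻¹)⁻¹ ^ k := by
  have h0 := inv_prime_pos hp
  have h1 : (p : ℝ)⁻¹ < 1 := (inv_prime_le_half hp).trans_lt (by norm_num)
  have hs : Summable fun e : ℕ ↦ ‖zetaReal (p ^ e) * ((p : ℝ)⁻¹) ^ e‖ := by
    simp only [zetaReal_apply_prime_pow hp, one_mul]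
    exact (summable_geometric_of_lt_one h0.le h1).norm
  rw [(tsum_pow_apply_prime_pow hp hs k).2]
  simp only [zetaReal_apply_prime_pow hp, one_mul]
  rw [tsum_geometric_of_lt_one h0.le h1]

lemma tsum_moebius_pow_apply_prime_pow (k : ℕ) {p : ℕ} (hp : p.Prime) (x : ℝ) :
    Summable (fun e : ℕ ↦ ‖(moebiusReal ^ k) (p ^ e) * x ^ e‖) ∧
      ∑' e : ℕ, (moebiusReal ^ k) (p ^ e) * x ^ e = (1 - x) ^ k := by
  have h0 : ∀ e ∉ range 2, moebiusReal (p ^ e) * x ^ e = 0 := by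
    intro e he
    have he' : 2 ≤ e := by simp at he; omega
    rw [ArithmeticFunction.intCoe_apply, ArithmeticFunction.moebius_apply_prime_pow hp (by omega),
      if_neg (by omega)]
    simp
  have h := tsum_pow_apply_prime_pow hp (summable_of_ne_finset_zero h0).norm k
  rw [tsum_eq_sum h0] at h
  refine ⟨h.1, h.2.trans ?_⟩
  simp [sum_range_succ, ArithmeticFunction.moebius_apply_prime hp, sub_eq_add_neg]

lemma tsum_tauR_mul_localSum (r : ℕ) {p : ℕ} (hp : p.Prime) :
    ∑' e : ℕ, (tauR r (p ^ e) : ℝ) * localSum r p e * ((p : ℝ)⁻¹) ^ e =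
      ∑' m : ℕ, (tauR r (p ^ m) : ℝ) * tauR (r + 1) (p ^ m) * ((p : ℝ)⁻¹) ^ m := by
  have h0 := inv_prime_pos hp
  have h1 := inv_prime_le_half hp
  set x : ℝ := (p : ℝ)⁻¹ with hx
  let F : ℕ × ℕ → ℝ := fun ij ↦
    (tauR r (p ^ ij.1) : ℝ) * tauR r (p ^ (ij.1 + ij.2)) * x ^ (ij.1 + ij.2)
  have hF : Summable F := by
    refine ((summable_succ_pow_mul_half_pow (r + r)).mul_of_nonneg
      (summable_succ_pow_mul_half_pow r) (fun j ↦ by positivity)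
      (fun j ↦ by positivity)).of_nonneg_of_le (fun ij ↦ by positivity) fun ij ↦ ?_
    have h2 := localSum_term_le r hp ij.1 ij.2
    have h3 := tauR_apply_prime_pow_le r hp ij.1
    calc F ij = (tauR r (p ^ ij.1) : ℝ) * x ^ ij.1 *
          ((tauR r (p ^ (ij.1 + ij.2)) : ℝ) * x ^ ij.2) := by simp only [F]; ring
      _ ≤ ((ij.1 : ℝ) + 1) ^ r * (1 / 2) ^ ij.1 *
          (((ij.1 : ℝ) + 1) ^ r * (((ij.2 : ℝ) + 1) ^ r * (1 / 2 : ℝ) ^ ij.2)) := by gcongr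
      _ = _ := by ring
  have e1 : ∑' ij, F ij = ∑' e : ℕ, (tauR r (p ^ e) : ℝ) * localSum r p e * x ^ e := by
    rw [hF.tsum_prod]
    refine tsum_congr fun e ↦ ?_
    rw [localSum, ← tsum_mul_left, ← tsum_mul_right]
    refine tsum_congr fun j ↦ ?_
    simp only [F]
    ring
  have e2 : ∑' ij, F ij =
      ∑' m : ℕ, (tauR r (p ^ m) : ℝ) * tauR (r + 1) (p ^ m) * x ^ m := by
    have hF' := (HasAntidiagonal.sigmaAntidiagonalEquivProd (A := ℕ)).summable_iff.mpr hF
    rw [← (HasAntidiagonal.sigmaAntidiagonalEquivProd (A := ℕ)).tsum_eq]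
    refine hF'.tsum_sigma.trans (tsum_congr fun m ↦ ?_)
    rw [tsum_fintype]
    change ∑ ij : antidiagonal m, F ij = _
    rw [sum_coe_sort (antidiagonal m) F, tauR_succ_apply_prime_pow r hp,
      Nat.sum_antidiagonal_eq_sum_range_succ_mk]
    push_cast
    rw [mul_sum, sum_mul]
    refine sum_congr rfl fun i hi ↦ ?_
    simp only [F]
    rw [Nat.add_sub_cancel' (Nat.lt_succ_iff.mp (mem_range.mp hi))]
    ring
  rw [← e1, e2]

lemma summable_tauMulFOne_prime_pow (r : ℕ) {p : ℕ} (hp : p.Prime) :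
    Summable fun e : ℕ ↦ ‖tauMulFOne r (p ^ e) * ((p : ℝ)⁻¹) ^ e‖ := by
  have h0 := inv_prime_pos hp
  refine ((summable_succ_pow_mul_half_pow (r + r)).mul_left (localBound r)).of_nonneg_of_le
    (fun e ↦ norm_nonneg _) fun e ↦ ?_
  rw [norm_mul, Real.norm_eq_abs, Real.norm_of_nonneg (by positivity), ← mul_assoc]
  exact mul_le_mul (abs_tauMulFOne_apply_prime_pow_le r hp e)
    (pow_le_pow_left₀ h0.le (inv_prime_le_half hp) e) (by positivity)
    (mul_nonneg (localBound_nonneg r) (by positivity))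

/-- The Euler factor of `constC0` is the local factor of `quotientFun` at `s = 1`. -/
lemma tsum_quotientFun_prime_pow (r : ℕ) {p : ℕ} (hp : p.Prime) :
    ∑' e : ℕ, quotientFun r (p ^ e) * ((p : ℝ)⁻¹) ^ e =
      (1 - 1 / (p : ℝ)) ^ (r ^ 2 + r) *
        ∑' j : ℕ, ((tauR r (p ^ j) : ℝ) * tauR (r + 1) (p ^ j)) / (p : ℝ) ^ j := by
  have h1 : (p : ℝ)⁻¹ < 1 := (inv_prime_le_half hp).trans_lt (by norm_num)
  have hM := tsum_moebius_pow_apply_prime_pow (r ^ 2) hp (p : ℝ)⁻¹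
  have hz : localSum r p 0 = (1 - (p : ℝ)⁻¹)⁻¹ ^ r := by
    rw [← tsum_zeta_pow_apply_prime_pow r hp, localSum]
    simp only [zero_add, cast_tauR]
  have hG : ∑' e : ℕ, tauMulFOne r (p ^ e) * ((p : ℝ)⁻¹) ^ e =
      (1 - (p : ℝ)⁻¹) ^ r *
        ∑' m : ℕ, (tauR r (p ^ m) : ℝ) * tauR (r + 1) (p ^ m) * ((p : ℝ)⁻¹) ^ m := by
    rw [← tsum_tauR_mul_localSum r hp, ← tsum_mul_left]
    refine tsum_congr fun e ↦ ?_
    rw [tauMulFOne_apply, fOne_apply_prime_pow r hp, hz, inv_pow, div_inv_eq_mul]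
    ring
  rw [quotientFun, (tsum_mul_apply_prime_pow hp (summable_tauMulFOne_prime_pow r hp) hM.1).2, hM.2,
    hG, pow_add]
  simp only [div_eq_mul_inv, inv_pow]
  ring

lemma tsum_quotientFun_prime_pow_pos (r : ℕ) {p : ℕ} (hp : p.Prime) :
    0 < ∑' e : ℕ, quotientFun r (p ^ e) * ((p : ℝ)⁻¹) ^ e := by
  have h0 := inv_prime_pos hp
  have h1 : (p : ℝ)⁻¹ ≤ 1 / 2 := inv_prime_le_half hp
  rw [tsum_quotientFun_prime_pow r hp]
  refine mul_pos (pow_pos (by rw [one_div]; linarith) _) ?_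
  have hs : Summable fun j : ℕ ↦
      ((tauR r (p ^ j) : ℝ) * tauR (r + 1) (p ^ j)) / (p : ℝ) ^ j := by
    refine (summable_succ_pow_mul_half_pow (r + (r + 1))).of_nonneg_of_le
      (fun j ↦ by positivity) fun j ↦ ?_
    have h2 := tauR_apply_prime_pow_le r hp j
    have h3 := tauR_apply_prime_pow_le (r + 1) hp j
    rw [div_eq_mul_inv, ← inv_pow, pow_add _ r]
    gcongr
  exact hs.tsum_pos (fun j ↦ by positivity) 0 (by simp [tauR_one])

/-- A bound for the tails of the local factors of `quotientFun`, on the scale `q = p^{-σ}`. -/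
lemma exists_tsum_abs_quotientFun_le (r : ℕ) {q₀ : ℝ} (hq0 : 0 < q₀) (hq1 : q₀ < 1) :
    ∃ K : ℝ, 0 ≤ K ∧ ∀ p : ℕ, p.Prime → ∀ q : ℝ, (p : ℝ)⁻¹ ≤ q → q ≤ q₀ →
      Summable (fun e : ℕ ↦ |quotientFun r (p ^ e)| * q ^ e) ∧
        ∑' e : ℕ, |quotientFun r (p ^ e)| * q ^ e ≤ 1 + K * q ^ 2 := by
  obtain ⟨B, hB, hBp⟩ := exists_abs_quotientFun_apply_prime_le r
  set Q := r + r + r ^ 2 + 1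
  have hS : Summable fun e : ℕ ↦ localBound r * (((e : ℝ) + 3) ^ Q * q₀ ^ e) := by
    simpa using (summable_add_pow_mul_geometric 3 Q hq0 hq1).mul_left (localBound r)
  have hS1 : Summable fun e : ℕ ↦ localBound r * (((e : ℝ) + 1) ^ Q * q₀ ^ e) := by
    simpa using (summable_add_pow_mul_geometric 1 Q hq0 hq1).mul_left (localBound r)
  have hb := localBound_nonneg r
  refine ⟨B + ∑' e : ℕ, localBound r * (((e : ℝ) + 3) ^ Q * q₀ ^ e),
    add_nonneg hB (tsum_nonneg fun e ↦ by positivity), fun p hp q hpq hqq ↦ ?_⟩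
  have hq : 0 < q := (inv_prime_pos hp).trans_le hpq
  have hs : Summable fun e : ℕ ↦ |quotientFun r (p ^ e)| * q ^ e := by
    refine hS1.of_nonneg_of_le (fun e ↦ by positivity) fun e ↦ ?_
    have := abs_quotientFun_apply_prime_pow_le r hp e
    rw [← mul_assoc]
    gcongr
  refine ⟨hs, ?_⟩
  rw [← hs.sum_add_tsum_nat_add 2]
  have ht : ∑' e : ℕ, |quotientFun r (p ^ (e + 2))| * q ^ (e + 2) ≤
      (∑' e : ℕ, localBound r * (((e : ℝ) + 3) ^ Q * q₀ ^ e)) * q ^ 2 := by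
    rw [← tsum_mul_right]
    refine ((summable_nat_add_iff 2).mpr hs).tsum_le_tsum (fun e ↦ ?_) (hS.mul_right _)
    have h1 := abs_quotientFun_apply_prime_pow_le r hp (e + 2)
    rw [show ((e + 2 : ℕ) : ℝ) + 1 = e + 3 by push_cast; ring] at h1
    rw [pow_add q, ← mul_assoc, ← mul_assoc]
    gcongr
  have hp1 : |quotientFun r p| * q ≤ B * q ^ 2 := by
    have : |quotientFun r p| ≤ B * q := (hBp p hp).trans (by gcongr)
    nlinarith
  have h1 := (isMultiplicative_quotientFun r).map_one
  simp only [sum_range_succ, range_zero, sum_empty, pow_zero, pow_one, h1, abs_one, mul_one,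
    zero_add]
  linarith

lemma two_rpow_neg_lt_one : (2 : ℝ) ^ (-(3 / 4) : ℝ) < 1 :=
  Real.rpow_lt_one_of_one_lt_of_neg one_lt_two (by norm_num)

lemma inv_le_rpow_neg {p : ℕ} (hp : p.Prime) :
    (p : ℝ)⁻¹ ≤ (p : ℝ) ^ (-(3 / 4) : ℝ) ∧
      (p : ℝ) ^ (-(3 / 4) : ℝ) ≤ (2 : ℝ) ^ (-(3 / 4) : ℝ) := by
  have h1 : (1 : ℝ) ≤ p := by exact_mod_cast hp.one_le
  constructor
  · rw [← Real.rpow_neg_one]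
    exact Real.rpow_le_rpow_of_exponent_le h1 (by norm_num)
  · exact Real.rpow_le_rpow_of_nonpos two_pos (by exact_mod_cast hp.two_le) (by norm_num)

lemma rpow_sq_eq (n : ℕ) : ((n : ℝ) ^ (-(3 / 4) : ℝ)) ^ 2 = (n : ℝ) ^ (-(3 / 2) : ℝ) := by
  rw [← Real.rpow_natCast, ← Real.rpow_mul (Nat.cast_nonneg n)]
  norm_num

lemma summable_rpow_neg_three_halves : Summable fun n : ℕ ↦ (n : ℝ) ^ (-(3 / 2) : ℝ) :=
  Real.summable_nat_rpow.mpr (by norm_num)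

lemma summable_abs_quotientFun (r : ℕ) :
    Summable fun n : ℕ ↦ |quotientFun r n| * (n : ℝ) ^ (-(3 / 4) : ℝ) := by
  have hm := isMultiplicative_quotientFun r
  obtain ⟨K, hK, h⟩ := exists_tsum_abs_quotientFun_le r (q₀ := (2 : ℝ) ^ (-(3 / 4) : ℝ))
    (by positivity) two_rpow_neg_lt_one
  have hpow : ∀ p e : ℕ, |quotientFun r (p ^ e)| * ((p ^ e : ℕ) : ℝ) ^ (-(3 / 4) : ℝ) =
      |quotientFun r (p ^ e)| * ((p : ℝ) ^ (-(3 / 4) : ℝ)) ^ e := by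
    intro p e
    rw [Nat.cast_pow, ← Real.rpow_natCast, ← Real.rpow_natCast,
      ← Real.rpow_mul (Nat.cast_nonneg p), ← Real.rpow_mul (Nat.cast_nonneg p), mul_comm (e : ℝ)]
  refine summable_of_multiplicative_of_tsum_prime_pow_le
    (c := fun n ↦ K * (n : ℝ) ^ (-(3 / 2) : ℝ)) (fun n ↦ by positivity) (by simp)
    (by simp [hm.map_one]) (fun {m n} hmn ↦ ?_) (fun {p} hp ↦ ?_)
    (summable_rpow_neg_three_halves.mul_left K) (fun n ↦ by positivity) (fun {p} hp ↦ ?_)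
  · rw [hm.map_mul_of_coprime hmn, abs_mul, Nat.cast_mul,
      Real.mul_rpow (Nat.cast_nonneg m) (Nat.cast_nonneg n)]
    ring
  · simp only [hpow]
    exact (h p hp _ (inv_le_rpow_neg hp).1 (inv_le_rpow_neg hp).2).1
  · simp only [hpow, ← rpow_sq_eq]
    exact (h p hp _ (inv_le_rpow_neg hp).1 (inv_le_rpow_neg hp).2).2

lemma quotientFun_div_prime_pow (r p e : ℕ) :
    quotientFun r (p ^ e) / ((p ^ e : ℕ) : ℝ) = quotientFun r (p ^ e) * ((p : ℝ)⁻¹) ^ e := by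
  rw [Nat.cast_pow, div_eq_mul_inv, inv_pow]

lemma tsum_quotientFun_div (r : ℕ) : ∑' n : ℕ, quotientFun r n / n = constC0 r := by
  have hm := isMultiplicative_quotientFun r
  have hs : Summable fun n : ℕ ↦ ‖quotientFun r n / n‖ := by
    refine (summable_abs_quotientFun r).of_nonneg_of_le (fun n ↦ norm_nonneg _) fun n ↦ ?_
    rcases Nat.eq_zero_or_pos n with rfl | hn
    · simp
    rw [norm_div, Real.norm_natCast, Real.norm_eq_abs, div_eq_mul_inv, ← Real.rpow_neg_one]
    gcongr
    · exact_mod_cast hn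
    · norm_num
  rw [← EulerProduct.eulerProduct_tprod (f := fun n : ℕ ↦ quotientFun r n / n)
    (by simp [hm.map_one]) (fun {m n} hmn ↦ ?_) hs (by simp), constC0]
  · refine tprod_congr fun p ↦ ?_
    rw [← tsum_quotientFun_prime_pow r p.2]
    exact tsum_congr fun e ↦ quotientFun_div_prime_pow r p e
  · rw [hm.map_mul_of_coprime hmn, Nat.cast_mul]
    ring

lemma constC0_ne_zero (r : ℕ) : constC0 r ≠ 0 := by
  obtain ⟨K, hK, h⟩ := exists_tsum_abs_quotientFun_le r (q₀ := 1 / 2) (by norm_num) (by norm_num)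
  have e : constC0 r = ∏' p : Nat.Primes,
      (1 + (∑' e : ℕ, quotientFun r ((p : ℕ) ^ e) * (((p : ℕ) : ℝ)⁻¹) ^ e - 1)) := by
    rw [constC0]
    refine tprod_congr fun p ↦ ?_
    rw [← tsum_quotientFun_prime_pow r p.2]
    ring
  rw [e]
  refine tprod_one_add_ne_zero_of_summable (fun p ↦ ?_) ?_
  · rw [add_sub_cancel]
    exact (tsum_quotientFun_prime_pow_pos r p.2).ne'
  · have hS : Summable fun p : Nat.Primes ↦ K * (((p : ℕ) : ℝ)⁻¹) ^ 2 := by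
      have : Summable fun n : ℕ ↦ K * ((n : ℝ)⁻¹) ^ 2 := by
        simpa using (Real.summable_nat_pow_inv (p := 2)).mpr (by norm_num) |>.mul_left K
      exact this.comp_injective Subtype.val_injective
    refine hS.of_nonneg_of_le (fun p ↦ norm_nonneg _) fun p ↦ ?_
    obtain ⟨hs, hle⟩ := h p p.2 _ le_rfl (inv_prime_le_half p.2)
    have hx := inv_prime_pos p.2
    have hs' : Summable fun e : ℕ ↦ quotientFun r ((p : ℕ) ^ e) * (((p : ℕ) : ℝ)⁻¹) ^ e := by
      refine Summable.of_norm (hs.congr fun e ↦ ?_)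
      rw [norm_mul, Real.norm_eq_abs, Real.norm_of_nonneg (by positivity)]
    have h1 := (isMultiplicative_quotientFun r).map_one
    have h2 := hs.sum_add_tsum_nat_add 1
    have h3 := hs'.sum_add_tsum_nat_add 1
    simp only [sum_range_one, pow_zero, h1, abs_one, mul_one] at h2 h3
    rw [← h3, add_sub_cancel_left]
    refine (tsum_of_norm_bounded ((summable_nat_add_iff 1).mpr hs).hasSum fun e ↦ ?_).trans
      (by linarith)
    rw [norm_mul, Real.norm_eq_abs, Real.norm_of_nonneg (by positivity)]

lemma tauMulFOne_one (n : ℕ) (hn : n ≠ 0) : tauMulFOne 1 n = 1 := by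
  have h1 : ∀ m : ℕ, m ≠ 0 → tauR 1 m = 1 := fun m hm ↦ by
    rw [tauR, pow_one, ArithmeticFunction.zeta_apply_ne hm]
  rw [tauMulFOne_apply, h1 n hn, Nat.cast_one, one_mul, fOne]
  refine prod_eq_one fun p hp ↦ ?_
  have hp' := Nat.prime_of_mem_primeFactors hp
  have hz := one_le_localSum_zero 1 hp'
  have : localSum 1 p (n.factorization p) = localSum 1 p 0 := by
    simp only [localSum, h1 _ (pow_pos hp'.pos _).ne']
  have := congrArg (· / localSum 1 p 0) this
  simp only [div_self (by linarith : localSum 1 p 0 ≠ 0)] at this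
  simpa only [localSum, zero_add, inv_pow, div_eq_mul_inv] using this

lemma quotientFun_one : quotientFun 1 = 1 := by
  have : tauMulFOne 1 = zetaReal := by
    ext n
    rcases Nat.eq_zero_or_pos n with rfl | hn
    · simp
    rw [tauMulFOne_one n hn.ne', ArithmeticFunction.natCoe_apply,
      ArithmeticFunction.zeta_apply_ne hn.ne', Nat.cast_one]
  rw [quotientFun, this, one_pow, pow_one, ArithmeticFunction.coe_zeta_mul_coe_moebius]

lemma constC0_one : constC0 1 = 1 := by
  rw [← tsum_quotientFun_div, quotientFun_one, tsum_eq_single 1]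
  · simp
  · intro n hn
    simp [hn]

/-- Fix `r ∈ ℕ`. Then
`Σ_{n ≤ x} τ_r(n) f₁(n) = (C₀ x (log x)^{r²−1}/(r²−1)!) (1 + O(1/log x))` as `x → ∞`. -/
theorem sum_tauR_mul_fOne (r : ℕ) (hr : 1 ≤ r) :
    (fun x : ℝ =>
        (∑ n ∈ Finset.Icc 1 ⌊x⌋₊, (tauR r n : ℝ) * fOne r n) -
          constC0 r * x * Real.log x ^ (r ^ 2 - 1) / (r ^ 2 - 1).factorial)
      =O[atTop] fun x : ℝ =>
        constC0 r * x * Real.log x ^ (r ^ 2 - 1) / (r ^ 2 - 1).factorial / Real.log x := by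
  have hsum : ∀ x : ℝ, ∑ n ∈ Finset.Icc 1 ⌊x⌋₊, (tauR r n : ℝ) * fOne r n =
      partialSum (tauMulFOne r) x := fun x ↦ rfl
  simp only [hsum]
  rcases hr.eq_or_lt with rfl | hr
  · refine Asymptotics.IsBigO.of_bound 1 ?_
    filter_upwards [eventually_ge_atTop (Real.exp 1)] with x hx
    have hx1 : 1 ≤ x := (Real.one_le_exp zero_le_one).trans hx
    have hL : 1 ≤ Real.log x := by rwa [Real.le_log_iff_exp_le (by linarith)]
    have hS : partialSum (tauMulFOne 1) x = ⌊x⌋₊ := by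
      rw [partialSum, sum_congr rfl fun n hn ↦ tauMulFOne_one n (by simp at hn; omega)]
      simp
    rw [constC0_one, hS]
    have h1 : 1 ≤ x / Real.log x := by
      rw [one_le_div (by linarith)]
      linarith [Real.log_le_sub_one_of_pos (by linarith : 0 < x)]
    have h2 := Nat.floor_le (by linarith : 0 ≤ x)
    have h3 := Nat.lt_floor_add_one x
    simp only [one_pow, Nat.sub_self, pow_zero, Nat.factorial_zero, Nat.cast_one, mul_one, one_mul,
      div_one, Real.norm_eq_abs]
    refine le_trans ?_ (h1.trans (le_abs_self _))
    rw [abs_le]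
    constructor <;> linarith
  · obtain ⟨k, hk⟩ : ∃ k, r ^ 2 = k + 2 := ⟨r ^ 2 - 2, by
      have : 2 ^ 2 ≤ r ^ 2 := Nat.pow_le_pow_left hr 2
      omega⟩
    obtain ⟨C, hC⟩ := exists_abs_partialSum_mul_zeta_pow_sub_le (quotientFun r) k
      (summable_abs_quotientFun r)
    rw [← hk, quotientFun_mul_zeta_pow, tsum_quotientFun_div] at hC
    have hk1 : r ^ 2 - 1 = k + 1 := by omega
    rw [hk1]
    have h0 := constC0_ne_zero r
    have hf : ((k + 1).factorial : ℝ) ≠ 0 := by exact_mod_cast (k + 1).factorial_ne_zero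
    refine Asymptotics.IsBigO.of_bound
      (|C| * 2 ^ k * ((k + 1).factorial : ℝ) / |constC0 r|) ?_
    filter_upwards [eventually_ge_atTop (Real.exp 1)] with x hx
    have hx1 : 1 ≤ x := (Real.one_le_exp zero_le_one).trans hx
    have hL : 1 ≤ Real.log x := by rwa [Real.le_log_iff_exp_le (by linarith)]
    have hL0 : 0 < Real.log x := by linarith
    have hC' := hC x hx1
    rw [show constC0 r * x * Real.log x ^ (k + 1) / (k + 1).factorial / Real.log x =
      constC0 r * (x * Real.log x ^ k / (k + 1).factorial) by
        rw [pow_succ]; field_simp, norm_mul,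
      Real.norm_eq_abs, Real.norm_eq_abs, Real.norm_of_nonneg (by positivity),
      show constC0 r * x * Real.log x ^ (k + 1) / (k + 1).factorial =
        constC0 r * (x * Real.log x ^ (k + 1) / (k + 1).factorial) by ring]
    have h0' := abs_pos.mpr h0
    calc _ ≤ _ := hC'
      _ ≤ |C| * x * (2 * Real.log x) ^ k := by
        gcongr
        · exact le_abs_self C
        · linarith
      _ = _ := by
        rw [mul_pow]
        field_simp
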